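/- Let ã : ℝ × ℝ → ℝ and y : ℝ × ℝ → ℝ be measurable, and define the lifting layer (Ly)(s, γ) = ∫_{ℝ²} ã(r − ⟨s, n(φ)⟩, φ − γ) · y(r, φ) d(r, φ) (Lebesgue integral over (r, φ) ∈ ℝ²). For h = (s₀, γ₀) ∈ ℝ² × ℝ define the transformed signal (T_h y)(r, φ) = y(r − ⟨s₀, n(φ)⟩, φ − γ₀). Then for all s ∈ ℝ² and γ ∈ ℝ, L(T_h y)(s, γ) = (Ly)(R(−γ₀)·(s − s₀), γ − γ₀); that is, the first layer is equivariant from the induced SE(2)-representation on sinograms to the left-translation representation on the group SE(2). -/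

import Mathlib

open Matrix MeasureTheory

/-- The normal direction `n(φ) = (cos φ, sin φ)`. -/
noncomputable def nvec (φ : ℝ) : Fin 2 → ℝ := ![Real.cos φ, Real.sin φ]

/-- The rotation matrix `R(γ)`. -/
noncomputable def Rmat (γ : ℝ) : Matrix (Fin 2) (Fin 2) ℝ :=
  !![Real.cos γ, -Real.sin γ; Real.sin γ, Real.cos γ]

/-- The Euclidean inner product on `ℝ²`. -/
def dot2 (u v : Fin 2 → ℝ) : ℝ := u 0 * v 0 + u 1 * v 1

/-- The lifting layer `(Ly)(s, γ) = ∫ ã(r − ⟨s, n(φ)⟩, φ − γ) · y(r, φ) d(r, φ)`. -/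
noncomputable def Lop (atil : ℝ × ℝ → ℝ) (y : ℝ × ℝ → ℝ) (s : Fin 2 → ℝ) (γ : ℝ) : ℝ :=
  ∫ p : ℝ × ℝ, atil (p.1 - dot2 s (nvec p.2), p.2 - γ) * y p

/-- The induced `SE(2)`-representation on sinograms:
`(T_(s₀,γ₀) y)(r, φ) = y(r − ⟨s₀, n(φ)⟩, φ − γ₀)`. -/
noncomputable def Tact (s₀ : Fin 2 → ℝ) (γ₀ : ℝ) (y : ℝ × ℝ → ℝ) : ℝ × ℝ → ℝ :=
  fun p => y (p.1 - dot2 s₀ (nvec p.2), p.2 - γ₀)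

theorem dot2_rmat_neg_mulVec (γ φ : ℝ) (u : Fin 2 → ℝ) :
    dot2 (Rmat (-γ) *ᵥ u) (nvec (φ - γ)) = dot2 u (nvec φ) := by
  have hφ : φ = (φ - γ) + γ := by ring
  conv_rhs => rw [hφ]
  simp only [dot2, nvec, Rmat, Matrix.mulVec, dotProduct, Fin.sum_univ_two, Matrix.of_apply,
    Matrix.cons_val_zero, Matrix.cons_val_one, Real.cos_neg, Real.sin_neg, Real.cos_add,
    Real.sin_add]
  ring

theorem dot2_sub_left (u v w : Fin 2 → ℝ) : dot2 (u - v) w = dot2 u w - dot2 v w := by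
  simp only [dot2, Pi.sub_apply]
  ring

theorem measurable_dot2_nvec (u : Fin 2 → ℝ) : Measurable fun φ => dot2 u (nvec φ) := by
  simp only [dot2, nvec, Matrix.cons_val_zero, Matrix.cons_val_one]
  fun_prop

/-- Shearing `r` by a measurable function of `φ` and translating `φ` preserves Lebesgue measure. -/
theorem measurePreserving_shear_translate {f : ℝ → ℝ} (hf : Measurable f) (c : ℝ) :
    MeasurePreserving fun p : ℝ × ℝ => (p.1 - f p.2, p.2 - c) := by
  have h : MeasurePreserving (fun p : ℝ × ℝ => (p.1 - c, p.2 - f p.1)) (volume.prod volume)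
      (volume.prod volume) :=
    (measurePreserving_sub_right volume c).skew_product
      (g := fun φ r => r - f φ) (by fun_prop)
      (.of_forall fun φ => (measurePreserving_sub_right volume (f φ)).map_eq)
  exact (Measure.measurePreserving_swap.comp h).comp Measure.measurePreserving_swap

/-- The first (lifting) layer is equivariant from the induced `SE(2)`-representation on
sinograms to the left-translation representation on the group `SE(2)`:
`L(T_h y)(s, γ) = (Ly)(h⁻¹·(s, γ)) = (Ly)(R(−γ₀)·(s − s₀), γ − γ₀)` for `h = (s₀, γ₀)`. -/
theorem stmt_14 (atil : ℝ × ℝ → ℝ) (hatil : Measurable atil)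
    (y : ℝ × ℝ → ℝ) (hy : Measurable y)
    (s₀ : Fin 2 → ℝ) (γ₀ : ℝ) :
    ∀ (s : Fin 2 → ℝ) (γ : ℝ),
      Lop atil (Tact s₀ γ₀ y) s γ = Lop atil y (Rmat (-γ₀) *ᵥ (s - s₀)) (γ - γ₀) := by
  intro s γ
  have hT := measurePreserving_shear_translate (measurable_dot2_nvec s₀) γ₀
  have hdot := measurable_dot2_nvec (Rmat (-γ₀) *ᵥ (s - s₀))
  unfold Lop
  symm
  rw [← hT.map_eq, integral_map hT.measurable.aemeasurable, hT.map_eq]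
  · refine integral_congr_ae (.of_forall fun p => ?_)
    simp only [Tact, dot2_rmat_neg_mulVec, dot2_sub_left, sub_sub_sub_cancel_right]
  · exact ((hatil.comp ((measurable_fst.sub (hdot.comp measurable_snd)).prodMk
      (measurable_snd.sub_const _))).mul hy).aestronglyMeasurable
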